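/- Let J be a real d×N matrix, Γ a real n×N matrix with singular value decomposition Γ = U Λ Vᵀ (U n×n orthogonal, V N×N orthogonal, Λ rectangular diagonal with diagonal entries λ₁,…,λ_n), and η > 0. Let V₁ consist of the first n columns of V, define ΔD = J Γᵀ (η I_n + Γ Γᵀ)⁻¹, and let Q = diag(√(λ₁⁴ + 2ηλ₁²)/(λ₁²+η), …, √(λ_n⁴ + 2ηλ_n²)/(λ_n²+η)). Then ‖J − ΔD Γ‖_F² − ‖J‖_F² = −‖J V₁ Q‖_F². -/

import Mathlib

open Matrix

/-- The Frobenius norm of a real matrix: `‖X‖_F = sqrt (∑ i j, X i j ^ 2)`. -/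
noncomputable def frobeniusNorm {m n : ℕ} (X : Matrix (Fin m) (Fin n) ℝ) : ℝ :=
  Real.sqrt (∑ i, ∑ j, (X i j) ^ 2)

theorem frobeniusNorm_sq {m n : ℕ} (X : Matrix (Fin m) (Fin n) ℝ) :
    frobeniusNorm X ^ 2 = (X * Xᵀ).trace := by
  rw [frobeniusNorm, Real.sq_sqrt (by positivity)]
  simp [Matrix.trace, Matrix.mul_apply, pow_two]

/-- A rectangular diagonal matrix times `Vᵀ` only sees the leading columns of `V`. -/
theorem rectDiagonal_mul_transpose {n N : ℕ} (hnN : n ≤ N) (V : Matrix (Fin N) (Fin N) ℝ)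
    (lam : Fin n → ℝ) :
    (Matrix.of fun (i : Fin n) (j : Fin N) => if (j : ℕ) = (i : ℕ) then lam i else 0) * Vᵀ =
      Matrix.diagonal lam * (V.submatrix id (Fin.castLE hnN))ᵀ := by
  ext i j
  have h : ∀ k : Fin N, (k : ℕ) = (i : ℕ) ↔ k = Fin.castLE hnN i := fun k => by
    simp [Fin.ext_iff]
  rw [Matrix.diagonal_mul]
  simp [Matrix.mul_apply, h]

/-- The decrease of the squared Frobenius norm after damping along orthonormal columns `W`. -/
theorem frobeniusNorm_sq_sub_damped {d n N : ℕ} (J : Matrix (Fin d) (Fin N) ℝ)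
    (W : Matrix (Fin N) (Fin n) ℝ) (hW : Wᵀ * W = 1) (p q : Fin n → ℝ)
    (hpq : ∀ i, q i * q i = 2 * p i - p i * p i) :
    frobeniusNorm (J - J * W * diagonal p * Wᵀ) ^ 2 - frobeniusNorm J ^ 2 =
      -(frobeniusNorm (J * W * diagonal q) ^ 2) := by
  have hQ : diagonal q * diagonal q = (2 : ℝ) • diagonal p - diagonal p * diagonal p := by
    rw [diagonal_mul_diagonal, diagonal_mul_diagonal, ← diagonal_smul, diagonal_sub]
    exact congrArg diagonal (funext fun i => by simp [hpq])
  have hPP : J * W * diagonal p * Wᵀ * (J * W * diagonal p * Wᵀ)ᵀ =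
      J * W * (diagonal p * diagonal p) * (J * W)ᵀ := by
    simp only [transpose_mul, transpose_transpose, diagonal_transpose, Matrix.mul_assoc]
    rw [← Matrix.mul_assoc Wᵀ W, hW, Matrix.one_mul]
  have hQQ : J * W * diagonal q * (J * W * diagonal q)ᵀ =
      J * W * (diagonal q * diagonal q) * (J * W)ᵀ := by
    simp only [transpose_mul, diagonal_transpose, Matrix.mul_assoc]
  have hJP : J * (J * W * diagonal p * Wᵀ)ᵀ = J * W * diagonal p * (J * W)ᵀ := by
    simp only [transpose_mul, transpose_transpose, diagonal_transpose, Matrix.mul_assoc]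
  have hPJ : J * W * diagonal p * Wᵀ * Jᵀ = J * W * diagonal p * (J * W)ᵀ := by
    simp only [transpose_mul, Matrix.mul_assoc]
  simp only [frobeniusNorm_sq]
  rw [hQQ, hQ, transpose_sub, Matrix.sub_mul, Matrix.mul_sub, Matrix.mul_sub, hPP, hJP, hPJ]
  simp only [Matrix.mul_sub, Matrix.sub_mul, Matrix.mul_smul, Matrix.smul_mul, trace_sub,
    trace_smul, smul_eq_mul]
  ring

/-- The regularized projector `Γᵀ (η I + Γ Γᵀ)⁻¹ Γ` in terms of a thin singular value
decomposition. -/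
theorem transpose_mul_regularized_inv_mul {n N : ℕ} (U : Matrix (Fin n) (Fin n) ℝ)
    (hU : U * Uᵀ = 1) (W : Matrix (Fin N) (Fin n) ℝ) (hW : Wᵀ * W = 1) (lam : Fin n → ℝ)
    {η : ℝ} (hη : 0 < η) {Γ : Matrix (Fin n) (Fin N) ℝ} (hΓ : Γ = U * diagonal lam * Wᵀ) :
    Γᵀ * (η • (1 : Matrix (Fin n) (Fin n) ℝ) + Γ * Γᵀ)⁻¹ * Γ =
      W * diagonal (fun i => lam i ^ 2 / (lam i ^ 2 + η)) * Wᵀ := by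
  have hU' : Uᵀ * U = 1 := mul_eq_one_comm.mp hU
  have hne : ∀ i, lam i ^ 2 + η ≠ 0 := fun i => by positivity
  have hG : η • (1 : Matrix (Fin n) (Fin n) ℝ) + Γ * Γᵀ =
      U * diagonal (fun i => lam i ^ 2 + η) * Uᵀ := by
    have hD : diagonal (fun i => lam i ^ 2 + η) =
        diagonal lam * diagonal lam + η • (1 : Matrix (Fin n) (Fin n) ℝ) := by
      rw [diagonal_mul_diagonal, ← diagonal_one, ← diagonal_smul, diagonal_add]
      exact congrArg diagonal (funext fun i => by simp [pow_two])
    rw [hD, hΓ, Matrix.mul_add, Matrix.add_mul, Matrix.mul_smul, Matrix.smul_mul,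
      Matrix.mul_one, hU, add_comm]
    simp only [transpose_mul, transpose_transpose, diagonal_transpose, Matrix.mul_assoc]
    rw [← Matrix.mul_assoc Wᵀ W, hW, Matrix.one_mul]
  have hinv : (η • (1 : Matrix (Fin n) (Fin n) ℝ) + Γ * Γᵀ)⁻¹ =
      U * diagonal (fun i => (lam i ^ 2 + η)⁻¹) * Uᵀ := by
    apply Matrix.inv_eq_right_inv
    rw [hG]
    simp only [Matrix.mul_assoc]
    rw [← Matrix.mul_assoc Uᵀ U, hU', Matrix.one_mul,
      ← Matrix.mul_assoc (diagonal _) (diagonal _), diagonal_mul_diagonal]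
    simp [hne, hU]
  have hD : diagonal (fun i => lam i ^ 2 / (lam i ^ 2 + η)) =
      diagonal lam * (diagonal (fun i => (lam i ^ 2 + η)⁻¹) * diagonal lam) := by
    rw [diagonal_mul_diagonal, diagonal_mul_diagonal]
    exact congrArg diagonal (funext fun i => by ring)
  rw [hinv, hD, hΓ]
  simp only [transpose_mul, transpose_transpose, diagonal_transpose, Matrix.mul_assoc]
  rw [← Matrix.mul_assoc Uᵀ U, hU', Matrix.one_mul, ← Matrix.mul_assoc Uᵀ U, hU', Matrix.one_mul]

/-- Exact expression for the decrease of the residue in Proposition 1: with the SVD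
`Γ = U Λ Vᵀ`, `ΔD = J Γᵀ (η I_n + Γ Γᵀ)⁻¹` and
`Q = diag(√(λᵢ⁴ + 2ηλᵢ²) / (λᵢ² + η))`, we have
`‖J − ΔD Γ‖_F² − ‖J‖_F² = −‖J V₁ Q‖_F²`. -/
theorem residue_decrease_closed_form {d n N : ℕ} (hnN : n ≤ N)
    (J : Matrix (Fin d) (Fin N) ℝ)
    (Γ : Matrix (Fin n) (Fin N) ℝ)
    (U : Matrix (Fin n) (Fin n) ℝ) (hU : U * Uᵀ = 1)
    (V : Matrix (Fin N) (Fin N) ℝ) (hV : V * Vᵀ = 1)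
    (lam : Fin n → ℝ)
    (Λ : Matrix (Fin n) (Fin N) ℝ)
    (hΛ : Λ = Matrix.of fun (i : Fin n) (j : Fin N) => if (j : ℕ) = (i : ℕ) then lam i else 0)
    (hSVD : Γ = U * Λ * Vᵀ)
    (η : ℝ) (hη : 0 < η)
    (V₁ : Matrix (Fin N) (Fin n) ℝ)
    (hV₁ : V₁ = V.submatrix id (Fin.castLE hnN))
    (ΔD : Matrix (Fin d) (Fin n) ℝ)
    (hΔD : ΔD = J * Γᵀ * (η • (1 : Matrix (Fin n) (Fin n) ℝ) + Γ * Γᵀ)⁻¹)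
    (Q : Matrix (Fin n) (Fin n) ℝ)
    (hQ : Q = Matrix.diagonal
      (fun i => Real.sqrt (lam i ^ 4 + 2 * η * lam i ^ 2) / (lam i ^ 2 + η))) :
    frobeniusNorm (J - ΔD * Γ) ^ 2 - frobeniusNorm J ^ 2 =
      -(frobeniusNorm (J * V₁ * Q) ^ 2) := by
  have hW : V₁ᵀ * V₁ = 1 := by
    rw [hV₁, transpose_submatrix, ← submatrix_mul _ _ _ _ _ Function.bijective_id,
      mul_eq_one_comm.mp hV, submatrix_one _ (Fin.castLE_injective hnN)]
  have hΓ : Γ = U * diagonal lam * V₁ᵀ := by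
    rw [hSVD, hΛ, hV₁, Matrix.mul_assoc, Matrix.mul_assoc, rectDiagonal_mul_transpose hnN]
  have hΔ : ΔD * Γ = J * V₁ * diagonal (fun i => lam i ^ 2 / (lam i ^ 2 + η)) * V₁ᵀ := by
    rw [hΔD, Matrix.mul_assoc J, Matrix.mul_assoc J,
      transpose_mul_regularized_inv_mul U hU V₁ hW lam hη hΓ]
    simp only [Matrix.mul_assoc]
  rw [hΔ, hQ]
  refine frobeniusNorm_sq_sub_damped J V₁ hW _ _ fun i => ?_
  have hne : lam i ^ 2 + η ≠ 0 := by positivity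
  rw [div_mul_div_comm, Real.mul_self_sqrt (by positivity)]
  field_simp
  ring
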